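/- Let h̃ be an M-dimensional random vector with i.i.d. standard complex Gaussian entries. For every deterministic Hermitian matrix A ∈ ℂ^{M×M} with all diagonal entries equal to 1, E[ |h̃^H A h̃|² ] − tr(A) ≥ M², and equality holds if and only if A = I_M. In particular, the identity matrix is the unique minimizer of A ↦ E{|h̃^H A h̃|²} − tr(A) over Hermitian matrices with unit diagonal. -/

import Mathlib

open MeasureTheory ProbabilityTheory Filter Matrix

/-- The standard complex Gaussian distribution `CN(0,1)`: real and imaginary parts are
independent real Gaussians with mean `0` and variance `1/2`. -/
noncomputable def stdComplexGaussian : Measure ℂ :=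
  ((gaussianReal 0 (1/2)).prod (gaussianReal 0 (1/2))).map
    (fun p : ℝ × ℝ => (p.1 : ℂ) + (p.2 : ℂ) * Complex.I)

instance : IsProbabilityMeasure stdComplexGaussian :=
  Measure.isProbabilityMeasure_map (by fun_prop)

theorem integral_sq_gaussianReal (v : NNReal) : ∫ x, x ^ 2 ∂gaussianReal 0 v = v := by
  have h := variance_fun_id_gaussianReal (μ := 0) (v := v)
  rw [variance_eq_integral (by fun_prop)] at h
  simpa [integral_id_gaussianReal] using h

theorem integral_pow_four_gaussianReal (v : NNReal) :
    ∫ x, x ^ 4 ∂gaussianReal 0 v = 3 * (v : ℝ) ^ 2 := by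
  have h := iteratedDeriv_mgf_zero (X := fun x : ℝ => x) (μ := gaussianReal 0 v)
    (by simp [integrableExpSet_fun_id_gaussianReal]) 4
  simp only [Pi.pow_apply] at h
  rw [← h, mgf_fun_id_gaussianReal]
  have key : ∀ p p' : ℝ → ℝ, (∀ t, HasDerivAt p (p' t) t) →
      deriv (fun t => p t * Real.exp (v * t ^ 2 / 2)) =
        fun t => (p' t + p t * (v * t)) * Real.exp (v * t ^ 2 / 2) := by
    intro p p' hp
    funext t
    have he : HasDerivAt (fun t : ℝ => (v : ℝ) * t ^ 2 / 2) (v * t) t := by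
      convert! (((hasDerivAt_id t).pow 2).const_mul (v : ℝ)).div_const 2 using 1
      simp; ring
    refine ((hp t).fun_mul he.exp).deriv.trans ?_
    ring
  have e0 : (fun t : ℝ => Real.exp (0 * t + v * t ^ 2 / 2)) =
      fun t => (fun _ => (1 : ℝ)) t * Real.exp (v * t ^ 2 / 2) := by simp
  rw [e0, iteratedDeriv_succ', iteratedDeriv_succ', iteratedDeriv_succ', iteratedDeriv_succ',
    iteratedDeriv_zero, key _ (fun _ => 0) (fun t => hasDerivAt_const t 1),
    key _ (fun _ => v), key _ (fun t => 2 * v ^ 2 * t),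
    key _ (fun t => 3 * v ^ 2 + 3 * v ^ 3 * t ^ 2)]
  · simp
  · intro t
    convert! (((hasDerivAt_id t).const_mul (3 * (v : ℝ) ^ 2)).add
      (((hasDerivAt_id t).pow 3).const_mul ((v : ℝ) ^ 3))) using 1
    · funext s; simp; ring
    · simp; ring
  · intro t
    convert! (((hasDerivAt_id t).pow 2).const_mul ((v : ℝ) ^ 2)).add_const (v : ℝ) using 1
    · funext s; simp; ring
    · simp; ring
  · intro t
    convert! (hasDerivAt_id t).const_mul (v : ℝ) using 1
    · funext s; simp
    · simp

theorem integrable_pow_gaussianReal (m : ℝ) (v : NNReal) (n : ℕ) :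
    Integrable (fun x => x ^ n) (gaussianReal m v) := by
  have h := (memLp_id_gaussianReal (μ := m) (v := v) n).integrable_norm_pow'
  refine h.mono' (by fun_prop) (ae_of_all _ fun x => ?_)
  simp

theorem measurePreserving_stdComplexGaussian :
    MeasurePreserving (fun p : ℝ × ℝ => (p.1 : ℂ) + (p.2 : ℂ) * Complex.I)
      ((gaussianReal 0 (1/2)).prod (gaussianReal 0 (1/2))) stdComplexGaussian :=
  ⟨by fun_prop, rfl⟩

theorem memLp_id_stdComplexGaussian (n : ℕ) : MemLp id n stdComplexGaussian := by
  rw [stdComplexGaussian, memLp_map_measure_iff (by fun_prop) (by fun_prop)]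
  have h : MemLp (fun x : ℝ => (x : ℂ)) n (gaussianReal 0 (1/2)) :=
    (memLp_id_gaussianReal n).ofReal
  have h1 := h.comp_fst (gaussianReal 0 (1/2))
  have h2 := (h.comp_snd (gaussianReal 0 (1/2))).mul_const Complex.I
  exact h1.add h2

theorem integrable_pow_mul_star_pow_stdComplexGaussian (a b : ℕ) :
    Integrable (fun z : ℂ => z ^ a * star z ^ b) stdComplexGaussian := by
  have h := (memLp_id_stdComplexGaussian (a + b)).integrable_norm_pow'
  refine h.mono' (by fun_prop) (ae_of_all _ fun z => ?_)
  simp [pow_add]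

theorem measurePreserving_I_mul_stdComplexGaussian :
    MeasurePreserving (fun z : ℂ => Complex.I * z) stdComplexGaussian stdComplexGaussian := by
  refine ⟨by fun_prop, ?_⟩
  have hneg : MeasurePreserving (fun x : ℝ => -x) (gaussianReal 0 (1/2)) (gaussianReal 0 (1/2)) :=
    ⟨by fun_prop, by simp [gaussianReal_map_neg]⟩
  have hrot := (hneg.prod (MeasurePreserving.id (gaussianReal 0 (1/2)))).comp
    (Measure.measurePreserving_swap (μ := gaussianReal 0 (1/2)) (ν := gaussianReal 0 (1/2)))
  have h := (measurePreserving_stdComplexGaussian.comp hrot).map_eq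
  rw [stdComplexGaussian, Measure.map_map (by fun_prop) (by fun_prop)]
  refine Eq.trans ?_ h
  congr 1
  funext p
  apply Complex.ext <;> simp

theorem integral_normSq_stdComplexGaussian :
    ∫ z, Complex.normSq z ∂stdComplexGaussian = 1 := by
  rw [stdComplexGaussian, integral_map (by fun_prop) (by fun_prop)]
  have h := integrable_pow_gaussianReal 0 (1/2) 2
  have e : ∀ p : ℝ × ℝ, Complex.normSq ((p.1 : ℂ) + (p.2 : ℂ) * Complex.I) = p.1 ^ 2 + p.2 ^ 2 :=
    fun p => Complex.normSq_add_mul_I _ _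
  simp_rw [e]
  rw [integral_add (h.comp_fst _) (h.comp_snd _),
    integral_fun_fst (fun x : ℝ => x ^ 2), integral_fun_snd (fun x : ℝ => x ^ 2),
    integral_sq_gaussianReal]
  norm_num

theorem integral_normSq_sq_stdComplexGaussian :
    ∫ z, Complex.normSq z ^ 2 ∂stdComplexGaussian = 2 := by
  rw [stdComplexGaussian, integral_map (by fun_prop) (by fun_prop)]
  have h2 := integrable_pow_gaussianReal 0 (1/2) 2
  have h4 := integrable_pow_gaussianReal 0 (1/2) 4
  have e : ∀ p : ℝ × ℝ, Complex.normSq ((p.1 : ℂ) + (p.2 : ℂ) * Complex.I) ^ 2 =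
      p.1 ^ 4 + p.2 ^ 4 + 2 * (p.1 ^ 2 * p.2 ^ 2) := fun p => by
    rw [Complex.normSq_add_mul_I]; ring
  simp_rw [e]
  rw [integral_add (by exact (h4.comp_fst _).add (h4.comp_snd _)) ((h2.mul_prod h2).const_mul 2),
    integral_add (h4.comp_fst _) (h4.comp_snd _), integral_const_mul,
    integral_fun_fst (fun x : ℝ => x ^ 4), integral_fun_snd (fun x : ℝ => x ^ 4),
    integral_prod_mul (fun x : ℝ => x ^ 2) (fun x : ℝ => x ^ 2),
    integral_sq_gaussianReal, integral_pow_four_gaussianReal]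
  norm_num

theorem integral_pow_mul_star_pow_stdComplexGaussian {a b : ℕ} (ha : a ≤ 2) (hb : b ≤ 2) :
    ∫ z, z ^ a * star z ^ b ∂stdComplexGaussian = if a = b then (a.factorial : ℂ) else 0 := by
  have hmul : ∀ z : ℂ, z * star z = (Complex.normSq z : ℂ) := Complex.mul_conj
  split_ifs with hab
  · subst hab
    simp_rw [← mul_pow, hmul, ← Complex.ofReal_pow]
    rw [integral_complex_ofReal]
    interval_cases a
    · simp
    · simp [integral_normSq_stdComplexGaussian]
    · simp [integral_normSq_sq_stdComplexGaussian]
  · have h := measurePreserving_I_mul_stdComplexGaussian.integral_comp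
      (Homeomorph.mulLeft₀ Complex.I Complex.I_ne_zero).measurableEmbedding
      (fun z : ℂ => z ^ a * star z ^ b)
    have e : ∀ z : ℂ, (Complex.I * z) ^ a * star (Complex.I * z) ^ b =
        (Complex.I ^ a * (-Complex.I) ^ b) * (z ^ a * star z ^ b) := fun z => by
      simp [mul_pow]; ring
    simp_rw [e] at h
    rw [integral_const_mul] at h
    have hne : Complex.I ^ a * (-Complex.I) ^ b - 1 ≠ 0 := by
      interval_cases a <;> interval_cases b <;> simp_all [Complex.ext_iff] <;> norm_num
    have h' : (Complex.I ^ a * (-Complex.I) ^ b - 1) *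
        ∫ z, z ^ a * star z ^ b ∂stdComplexGaussian = 0 := by
      rw [sub_mul, h, one_mul, sub_self]
    exact (mul_eq_zero.mp h').resolve_left hne

section Pi

variable {ι : Type*} [Fintype ι] [DecidableEq ι]

theorem fourfold_mul_eq_prod (x : ι → ℂ) (i j k l : ι) :
    star (x i) * x j * (x k * star (x l)) =
      ∏ m, x m ^ ((if j = m then 1 else 0) + (if k = m then 1 else 0)) *
        star (x m) ^ ((if i = m then 1 else 0) + (if l = m then 1 else 0)) := by
  simp only [pow_add, Finset.prod_mul_distrib, pow_ite, pow_one, pow_zero, Finset.prod_ite_eq,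
    Finset.mem_univ, if_true]
  ring

theorem integrable_fourfold_pi_stdComplexGaussian (i j k l : ι) :
    Integrable (fun x : ι → ℂ => star (x i) * x j * (x k * star (x l)))
      (Measure.pi fun _ => stdComplexGaussian) := by
  simp_rw [fourfold_mul_eq_prod]
  exact Integrable.fintype_prod_dep
    fun m => integrable_pow_mul_star_pow_stdComplexGaussian _ _

theorem integral_fourfold_pi_stdComplexGaussian (i j k l : ι) :
    ∫ x : ι → ℂ, star (x i) * x j * (x k * star (x l)) ∂(Measure.pi fun _ => stdComplexGaussian) =
      (if i = j then if k = l then 1 else 0 else 0) +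
        (if i = k then if j = l then 1 else 0 else 0) := by
  simp_rw [fourfold_mul_eq_prod]
  rw [integral_fintype_prod_eq_prod (fun m z =>
    z ^ ((if j = m then 1 else 0) + (if k = m then 1 else 0)) *
      star z ^ ((if i = m then 1 else 0) + (if l = m then 1 else 0)))]
  have hle : ∀ p q m : ι, (if p = m then 1 else 0) + (if q = m then 1 else 0) ≤ 2 := by
    intro p q m; split_ifs <;> simp
  simp_rw [integral_pow_mul_star_pow_stdComplexGaussian (hle _ _ _) (hle _ _ _)]
  by_cases hij : i = j
  · subst hij
    by_cases hkl : k = l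
    · subst hkl
      by_cases hik : i = k
      · subst hik
        rw [Finset.prod_eq_single i (by intro m _ hm; simp [hm.symm]) (by simp)]
        simp; norm_num
      · rw [Finset.prod_eq_one]
        · simp [hik]
        · intro m _
          by_cases h1 : i = m <;> by_cases h2 : k = m <;> simp_all
    · rw [Finset.prod_eq_zero (Finset.mem_univ k)]
      · by_cases hik : i = k <;> simp_all
      · by_cases hik : i = k <;> simp [hik, Ne.symm hkl, eq_comm]
  · by_cases hik : i = k
    · subst hik
      by_cases hjl : j = l
      · subst hjl
        rw [Finset.prod_eq_one]
        · simp [hij]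
        · intro m _
          by_cases h1 : i = m <;> by_cases h2 : j = m <;> simp_all
      · rw [Finset.prod_eq_zero (Finset.mem_univ j)]
        · simp [hij, hjl]
        · simp [hij, Ne.symm hjl]
    · rw [Finset.prod_eq_zero (Finset.mem_univ i)]
      · simp [hij, hik]
      · rw [if_neg (by simp [Ne.symm hij, Ne.symm hik]; lia)]

theorem integral_norm_sq_quadraticForm_pi_stdComplexGaussian (A : Matrix ι ι ℂ) :
    ∫ x : ι → ℂ, ‖star x ⬝ᵥ A *ᵥ x‖ ^ 2 ∂(Measure.pi fun _ => stdComplexGaussian) =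
      ‖A.trace‖ ^ 2 + ∑ i, ∑ j, ‖A i j‖ ^ 2 := by
  have expand : ∀ x : ι → ℂ, ((‖star x ⬝ᵥ A *ᵥ x‖ ^ 2 : ℝ) : ℂ) =
      ∑ i, ∑ j, ∑ k, ∑ l,
        A i j * star (A k l) * (star (x i) * x j * (x k * star (x l))) := by
    intro x
    have hq : star x ⬝ᵥ A *ᵥ x = ∑ i, ∑ j, star (x i) * A i j * x j := by
      simp [dotProduct, mulVec, Finset.mul_sum, mul_assoc]
    rw [Complex.ofReal_pow, ← Complex.mul_conj', hq]
    simp only [map_sum, map_mul, Finset.sum_mul]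
    simp only [Finset.mul_sum]
    refine Finset.sum_congr rfl fun i _ => Finset.sum_congr rfl fun j _ => Finset.sum_congr rfl
      fun k _ => Finset.sum_congr rfl fun l _ => ?_
    simp
    ring
  have hint := fun i j k l => (integrable_fourfold_pi_stdComplexGaussian (ι := ι) i j k l).const_mul
    (A i j * star (A k l))
  apply Complex.ofReal_injective
  rw [← integral_complex_ofReal]
  simp_rw [expand]
  rw [integral_finsetSum _ fun i _ => integrable_finsetSum _ fun j _ =>
    integrable_finsetSum _ fun k _ => integrable_finsetSum _ fun l _ => hint i j k l]
  simp_rw [integral_finsetSum _ fun j _ => integrable_finsetSum _ fun k _ =>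
    integrable_finsetSum _ fun l _ => hint _ j k l]
  simp_rw [integral_finsetSum _ fun k _ => integrable_finsetSum _ fun l _ => hint _ _ k l,
    integral_finsetSum _ fun l _ => hint _ _ _ l, integral_const_mul,
    integral_fourfold_pi_stdComplexGaussian, mul_add, Finset.sum_add_distrib]
  push_cast
  simp_rw [← Complex.mul_conj']
  congr 1
  · simp [trace, Finset.sum_mul_sum]
  · simp

end Pi

/-- Remark 4. For `h̃` with i.i.d. standard complex Gaussian entries and
any deterministic Hermitian matrix `A` with unit diagonal,
`E[|h̃ᴴ A h̃|²] − tr A ≥ M²`, with equality if and only if `A = I_M`; i.e. the identity is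
the unique minimizer of `A ↦ E[|h̃ᴴ A h̃|²] − tr A` over Hermitian unit-diagonal matrices. -/
theorem identity_minimizes_quadratic_moment
    {Ω : Type*} [MeasurableSpace Ω] (μ : Measure Ω) [IsProbabilityMeasure μ]
    (M : ℕ) (htil : Ω → Fin M → ℂ)
    (hdist : Measure.map htil μ = Measure.pi fun _ : Fin M => stdComplexGaussian)
    (A : Matrix (Fin M) (Fin M) ℂ) (hA : A.IsHermitian) (hdiag : ∀ i, A i i = 1) :
    (M : ℝ) ^ 2 ≤
      (∫ ω, ‖(star (htil ω)) ⬝ᵥ A.mulVec (htil ω)‖ ^ 2 ∂μ) - (A.trace).re ∧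
    (((∫ ω, ‖(star (htil ω)) ⬝ᵥ A.mulVec (htil ω)‖ ^ 2 ∂μ) - (A.trace).re = (M : ℝ) ^ 2)
      ↔ A = 1) := by
  
  have hmeas : AEMeasurable htil μ :=
    AEMeasurable.of_map_ne_zero (hdist ▸ IsProbabilityMeasure.ne_zero _)
  have hmoment : ∫ ω, ‖(star (htil ω)) ⬝ᵥ A.mulVec (htil ω)‖ ^ 2 ∂μ =
      ‖A.trace‖ ^ 2 + ∑ i, ∑ j, ‖A i j‖ ^ 2 := by
    rw [← integral_norm_sq_quadraticForm_pi_stdComplexGaussian, ← hdist,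
      integral_map hmeas (by unfold dotProduct mulVec dotProduct; fun_prop)]
  have htrace : A.trace = M := by simp [trace, hdiag]
  have hrow : ∀ i, ∑ j, ‖A i j‖ ^ 2 = 1 + ∑ j ∈ Finset.univ.erase i, ‖A i j‖ ^ 2 := by
    intro i
    rw [← Finset.add_sum_erase _ _ (Finset.mem_univ i), hdiag]
    simp
  have hvalue : (∫ ω, ‖(star (htil ω)) ⬝ᵥ A.mulVec (htil ω)‖ ^ 2 ∂μ) - (A.trace).re =
      (M : ℝ) ^ 2 + ∑ i, ∑ j ∈ Finset.univ.erase i, ‖A i j‖ ^ 2 := by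
    rw [hmoment, htrace]
    simp_rw [hrow, Finset.sum_add_distrib]
    simp
    ring
  have hoff : ∀ i, 0 ≤ ∑ j ∈ Finset.univ.erase i, ‖A i j‖ ^ 2 :=
    fun i => Finset.sum_nonneg fun j _ => sq_nonneg _
  rw [hvalue]
  refine ⟨le_add_of_nonneg_right (Finset.sum_nonneg fun i _ => hoff i), ?_⟩
  rw [add_eq_left, Finset.sum_eq_zero_iff_of_nonneg fun i _ => hoff i]
  constructor
  · intro h
    ext i j
    by_cases hij : i = j
    · subst hij
      simp [hdiag]
    · have hi := (Finset.sum_eq_zero_iff_of_nonneg fun j _ => sq_nonneg _).mp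
        (h i (Finset.mem_univ i)) j (by simp [Ne.symm hij])
      simpa [hij] using hi
  · rintro rfl i -
    refine Finset.sum_eq_zero fun j hj => ?_
    simp [one_apply_ne (Finset.ne_of_mem_erase hj).symm]
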